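/- There is no universal approximable semidistribution: for every approximable semidistribution P₀ on ℕ there exists an approximable semidistribution Q on ℕ such that no constant c > 0 satisfies P₀(x) ≥ c·Q(x) for all x. -/

import Mathlib

open Filter Topology

/-- A semidistribution on ℕ: nonnegative with convergent total sum at most 1. -/
def IsSemidistribution (P : ℕ → ℝ) : Prop :=
  (∀ x, 0 ≤ P x) ∧ Summable P ∧ ∑' x, P x ≤ 1

/-- `P` is approximable if some computable `ℚ`-valued function converges to it. -/
def Approximable (P : ℕ → ℝ) : Prop :=
  ∃ f : ℕ → ℕ → ℚ, Computable₂ f ∧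
    ∀ x, Tendsto (fun t => ((f t x : ℚ) : ℝ)) atTop (𝓝 (P x))

/-- The pair of the numerator (folded into `ℕ`) and the denominator, coded as a natural number. -/
def Rat.code (q : ℚ) : ℕ := Nat.pair (Equiv.intEquivNat q.num) q.den

/-- `m` codes a reduced fraction with positive denominator. -/
def IsRatCode (m : ℕ) : Prop :=
  0 < m.unpair.2 ∧ ((m.unpair.1 + 1) / 2).Coprime m.unpair.2

instance : DecidablePred IsRatCode := fun _ => inferInstanceAs (Decidable (_ ∧ _))

theorem Equiv.intEquivNat_ofNat (n : ℕ) : Equiv.intEquivNat (Int.ofNat n) = 2 * n := rfl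

theorem Equiv.intEquivNat_negSucc (n : ℕ) : Equiv.intEquivNat (Int.negSucc n) = 2 * n + 1 := rfl

theorem Int.natAbs_eq_intEquivNat_add_one_div_two (z : ℤ) :
    z.natAbs = (Equiv.intEquivNat z + 1) / 2 := by
  cases z with
  | ofNat n => rw [Equiv.intEquivNat_ofNat]; simp; omega
  | negSucc n => rw [Equiv.intEquivNat_negSucc]; simp; omega

theorem Rat.mem_range_code (m : ℕ) : m ∈ Set.range Rat.code ↔ IsRatCode m := by
  constructor
  · rintro ⟨q, rfl⟩
    simp only [IsRatCode, Rat.code, Nat.unpair_pair, ← Int.natAbs_eq_intEquivNat_add_one_div_two]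
    exact ⟨q.den_pos, q.reduced⟩
  · rintro ⟨h1, h2⟩
    refine ⟨⟨Equiv.intEquivNat.symm m.unpair.1, m.unpair.2, h1.ne', ?_⟩, ?_⟩
    · rw [Int.natAbs_eq_intEquivNat_add_one_div_two, Equiv.apply_symm_apply]
      exact h2
    · simp [Rat.code]

/-- The `Primcodable` encoding of `q` is the index of `q.code` in the set of codes. -/
theorem Rat.encode_eq_count (q : ℚ) :
    @Encodable.encode ℚ Primcodable.toEncodable q = Nat.count IsRatCode q.code := by
  change @Nat.count (fun m => m ∈ Set.range (@Encodable.encode ℚ Rat.instEncodable))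
    (@Encodable.decidableRangeEncode ℚ Rat.instEncodable) q.code = _
  simp only [Nat.count_eq_card_filter_range]
  congr 1
  ext m
  simp only [Finset.mem_filter, ← Rat.mem_range_code]
  rfl
theorem Primrec.nat_count {p : ℕ → Prop} [DecidablePred p] (hp : PrimrecPred p) :
    Primrec (Nat.count p) := by
  have hstep : Primrec₂ fun (n r : ℕ) => r + if p n then 1 else 0 :=
    Primrec.nat_add.comp Primrec.snd
      (Primrec.ite (hp.comp Primrec.fst) (Primrec.const 1) (Primrec.const 0))
  refine (Primrec.nat_rec₁ 0 hstep).of_eq fun n => ?_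
  induction n with
  | zero => simp
  | succ n ih => rw [Nat.count_succ, ← ih]

theorem PrimrecRel.nat_coprime : PrimrecRel Nat.Coprime := by
  have hdvd : PrimrecRel fun k n : ℕ => n % k = 0 :=
    Primrec.eq.comp (Primrec.nat_mod.comp Primrec.snd Primrec.fst) (Primrec.const 0)
  have hstep : PrimrecRel fun (k : ℕ) (y : ℕ × ℕ) => ¬ (y.1 % k = 0 ∧ y.2 % k = 0) ∨ k = 1 :=
    (((hdvd.comp Primrec.fst (Primrec.fst.comp Primrec.snd)).and
      (hdvd.comp Primrec.fst (Primrec.snd.comp Primrec.snd))).not).or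
      (Primrec.eq.comp Primrec.fst (Primrec.const 1))
  refine (hstep.forall_mem_list.comp
    (f := fun y : ℕ × ℕ => List.range (y.1 + y.2 + 2)) (g := fun y => y)
    (Primrec.list_range.comp
      (Primrec.succ.comp (Primrec.succ.comp (Primrec.nat_add.comp Primrec.fst Primrec.snd))))
    Primrec.id).of_eq fun ⟨a, b⟩ => ?_
  simp only [← Nat.dvd_iff_mod_eq_zero, List.mem_range]
  constructor
  · intro h
    rcases Nat.eq_zero_or_pos (a.gcd b) with h0 | h0
    · obtain ⟨rfl, rfl⟩ := Nat.gcd_eq_zero_iff.1 h0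
      simpa using h 0 (by simp)
    · have hle : a.gcd b < a + b + 2 := by
        rcases Nat.eq_zero_or_pos a with rfl | ha
        · simp
        · have := Nat.gcd_le_left b ha; omega
      exact (h _ hle).resolve_left fun hn => hn ⟨Nat.gcd_dvd_left a b, Nat.gcd_dvd_right a b⟩
  · intro h k _
    by_cases hk : k ∣ a ∧ k ∣ b
    · exact Or.inr (Nat.eq_one_of_dvd_coprimes h hk.1 hk.2)
    · exact Or.inl hk

theorem PrimrecPred.isRatCode : PrimrecPred IsRatCode := by
  have h1 : Primrec fun m : ℕ => m.unpair.1 := Primrec.fst.comp Primrec.unpair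
  have h2 : Primrec fun m : ℕ => m.unpair.2 := Primrec.snd.comp Primrec.unpair
  exact (Primrec.nat_lt.comp (Primrec.const 0) h2).and
    (PrimrecRel.nat_coprime.comp
      (Primrec.nat_div.comp (Primrec.succ.comp h1) (Primrec.const 2)) h2)

theorem Primrec.rat_of_code {α : Type*} [Primcodable α] {f : α → ℚ}
    (hf : Primrec fun a => (f a).code) : Primrec f :=
  Primrec.encode_iff.1 <| ((Primrec.nat_count PrimrecPred.isRatCode).comp hf).of_eq fun a =>
    (Rat.encode_eq_count (f a)).symm

theorem Computable.rat_code : Computable Rat.code := by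
  have hex (q : ℚ) : ∃ m, IsRatCode m ∧
      @Encodable.encode ℚ Primcodable.toEncodable q = Nat.count IsRatCode m :=
    ⟨q.code, (Rat.mem_range_code _).1 ⟨q, rfl⟩, Rat.encode_eq_count q⟩
  have hP : PrimrecPred fun x : ℚ × ℕ =>
      IsRatCode x.2 ∧ @Encodable.encode ℚ Primcodable.toEncodable x.1 = Nat.count IsRatCode x.2 :=
    (PrimrecPred.isRatCode.comp Primrec.snd).and
      (Primrec.eq.comp (Primrec.encode.comp Primrec.fst)
        ((Primrec.nat_count PrimrecPred.isRatCode).comp Primrec.snd))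
  refine (Computable.find hP.computablePred hex).of_eq fun q => ?_
  obtain ⟨h1, h2⟩ := Nat.find_spec (hex q)
  refine Nat.count_injective h1 ((Rat.mem_range_code _).1 ⟨q, rfl⟩) ?_
  rw [← h2, Rat.encode_eq_count]

theorem Primrec.nat_pow : Primrec₂ ((· ^ ·) : ℕ → ℕ → ℕ) :=
  Primrec₂.unpaired'.1 Nat.Primrec.pow

theorem Rat.inv_natCast_lt_iff_code {d : ℕ} (hd : 0 < d) (q : ℚ) :
    (d : ℚ)⁻¹ < q ↔ q.code.unpair.1 % 2 = 0 ∧ q.code.unpair.2 < q.code.unpair.1 / 2 * d := by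
  have hd' : (0 : ℚ) < d := by exact_mod_cast hd
  have hq : (0 : ℚ) < q.den := by exact_mod_cast q.den_pos
  have key : (d : ℚ)⁻¹ < q ↔ (q.den : ℤ) < q.num * d := by
    conv_lhs => rw [← Rat.num_div_den q]
    rw [inv_eq_one_div, div_lt_div_iff₀ hd' hq, one_mul]
    exact_mod_cast Iff.rfl
  rw [key]
  simp only [Rat.code, Nat.unpair_pair]
  generalize q.den = b
  cases q.num with
  | ofNat n =>
    rw [Equiv.intEquivNat_ofNat]
    simp
    exact_mod_cast Iff.rfl
  | negSucc n =>
    rw [Equiv.intEquivNat_negSucc]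
    have : Int.negSucc n * (d : ℤ) ≤ 0 := mul_nonpos_of_nonpos_of_nonneg (by omega) (by omega)
    constructor <;> intro h <;> omega

theorem Computable.decide_inv_natCast_lt {α : Type*} [Primcodable α] {d : α → ℕ} {g : α → ℚ}
    (hd : Computable d) (hd0 : ∀ a, 0 < d a) (hg : Computable g) :
    Computable fun a => decide ((d a : ℚ)⁻¹ < g a) := by
  have h1 : Primrec fun x : ℕ × ℕ => x.1.unpair.1 :=
    Primrec.fst.comp (Primrec.unpair.comp Primrec.fst)
  have h2 : Primrec fun x : ℕ × ℕ => x.1.unpair.2 :=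
    Primrec.snd.comp (Primrec.unpair.comp Primrec.fst)
  have hR : PrimrecPred fun x : ℕ × ℕ =>
      x.1.unpair.1 % 2 = 0 ∧ x.1.unpair.2 < x.1.unpair.1 / 2 * x.2 :=
    (Primrec.eq.comp (Primrec.nat_mod.comp h1 (Primrec.const 2)) (Primrec.const 0)).and
      (Primrec.nat_lt.comp h2
        (Primrec.nat_mul.comp (Primrec.nat_div.comp h1 (Primrec.const 2)) Primrec.snd))
  refine (hR.decide.to_comp.comp ((Computable.rat_code.comp hg).pair hd)).of_eq fun a => ?_
  exact decide_eq_decide.2 (Rat.inv_natCast_lt_iff_code (hd0 a) _).symm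

theorem Rat.code_inv_natCast {d : ℕ} (hd : 0 < d) : ((d : ℚ)⁻¹).code = Nat.pair 2 d := by
  rw [Rat.code, Rat.inv_natCast_num_of_pos hd, Rat.inv_natCast_den_of_pos hd]
  rfl

theorem Primrec.inv_natCast : Primrec fun d : ℕ => ((d + 1 : ℕ) : ℚ)⁻¹ :=
  Primrec.rat_of_code <| (Primrec₂.natPair.comp (Primrec.const 2) Primrec.succ).of_eq fun d =>
    (Rat.code_inv_natCast d.succ_pos).symm

/-- The pointer for block `k`: it advances whenever the current value of the approximation at the
candidate it designates exceeds `4⁻ᵏ`. -/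
def pointer (f : ℕ → ℕ → ℚ) (k : ℕ) : ℕ → ℕ
  | 0 => 0
  | t + 1 =>
    bif decide (((4 ^ k : ℕ) : ℚ)⁻¹ < f t (Nat.pair k (pointer f k t).unpair.1))
    then pointer f k t + 1 else pointer f k t

theorem computable_pointer {f : ℕ → ℕ → ℚ} (hf : Computable₂ f) : Computable₂ (pointer f) := by
  have hstep : Computable₂ fun (x : ℕ × ℕ) (y : ℕ × ℕ) =>
      bif decide (((4 ^ x.1 : ℕ) : ℚ)⁻¹ < f y.1 (Nat.pair x.1 y.2.unpair.1))
      then y.2 + 1 else y.2 := by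
    have hk : Computable fun z : (ℕ × ℕ) × ℕ × ℕ => z.1.1 := Computable.fst.comp Computable.fst
    have hp : Computable fun z : (ℕ × ℕ) × ℕ × ℕ => z.2.2 := Computable.snd.comp Computable.snd
    have hd : Computable fun z : (ℕ × ℕ) × ℕ × ℕ => 4 ^ z.1.1 :=
      Primrec.nat_pow.to_comp.comp (Computable.const 4) hk
    have hv : Computable fun z : (ℕ × ℕ) × ℕ × ℕ => f z.2.1 (Nat.pair z.1.1 z.2.2.unpair.1) :=
      hf.comp (Computable.fst.comp Computable.snd)
        (Primrec₂.natPair.to_comp.comp hk (Computable.fst.comp (Computable.unpair.comp hp)))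
    exact Computable.cond
      (Computable.decide_inv_natCast_lt hd (fun _ => by positivity) hv)
      (Computable.succ.comp hp) hp
  refine (Computable.nat_rec (f := fun x : ℕ × ℕ => x.2) (g := fun _ => 0)
    Computable.snd (Computable.const 0) hstep).of_eq fun ⟨k, t⟩ => ?_
  induction t with
  | zero => rfl
  | succ t ih =>
    simp only [pointer] at ih ⊢
    rw [ih]

theorem monotone_pointer (f : ℕ → ℕ → ℚ) (k : ℕ) : Monotone (pointer f k) :=
  monotone_nat_of_le_succ fun t => by
    rw [pointer, Bool.cond_eq_ite]
    split_ifs <;> omega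

theorem exists_le_unpair_fst_eq (n i : ℕ) : ∃ p, n ≤ p ∧ p.unpair.1 = i :=
  ⟨Nat.pair i n, Nat.right_le_pair i n, by simp⟩

theorem bddAbove_range_pointer {f : ℕ → ℕ → ℚ} {k i T : ℕ}
    (h : ∀ t ≥ T, f t (Nat.pair k i) ≤ ((4 ^ k : ℕ) : ℚ)⁻¹) :
    ∃ p, ∀ t, pointer f k t ≤ p := by
  obtain ⟨p, hTp, hpi⟩ := exists_le_unpair_fst_eq (pointer f k T) i
  have hge : ∀ t ≥ T, pointer f k t ≤ p := by
    intro t ht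
    induction t, ht using Nat.le_induction with
    | base => exact hTp
    | succ t ht ih =>
      rw [pointer, Bool.cond_decide]
      split_ifs with hlt
      · refine Nat.lt_of_le_of_ne ih fun heq => ?_
        rw [heq, hpi] at hlt
        exact absurd (h t ht) hlt.not_ge
      · exact ih
  refine ⟨p, fun t => ?_⟩
  rcases le_total T t with ht | ht
  · exact hge t ht
  · exact (monotone_pointer f k ht).trans hTp

theorem exists_eventually_eq_of_monotone_of_le {u : ℕ → ℕ} (hu : Monotone u) {p : ℕ}
    (hp : ∀ t, u t ≤ p) : ∃ l, ∀ᶠ t in atTop, u t = l := by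
  have h := tendsto_atTop_ciSup hu ⟨p, Set.forall_mem_range.2 hp⟩
  rw [nhds_discrete, tendsto_pure] at h
  exact ⟨_, h⟩

/-- In every block the pointer is eventually constant, and the point it settles on has mass at most
`4⁻ᵏ`. -/
theorem exists_pointer_limit {P : ℕ → ℝ} (hP : Summable P) {f : ℕ → ℕ → ℚ}
    (hf : ∀ x, Tendsto (fun t => (f t x : ℝ)) atTop (𝓝 (P x))) (k : ℕ) :
    ∃ l, (∀ᶠ t in atTop, pointer f k t = l) ∧
      P (Nat.pair k l.unpair.1) ≤ ((4 ^ k : ℕ) : ℝ)⁻¹ := by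
  have hpos : (0 : ℝ) < ((4 ^ k : ℕ) : ℝ)⁻¹ := by positivity
  have hcast : ((((4 ^ k : ℕ) : ℚ)⁻¹ : ℚ) : ℝ) = ((4 ^ k : ℕ) : ℝ)⁻¹ := by push_cast; rfl
  have hinj : Function.Injective (Nat.pair k) := fun a b h => (Nat.pair_eq_pair.1 h).2
  obtain ⟨i, hi⟩ :=
    ((hP.comp_injective hinj).tendsto_atTop_zero.eventually (gt_mem_nhds hpos)).exists
  obtain ⟨T, hT⟩ := eventually_atTop.1 ((hf (Nat.pair k i)).eventually (gt_mem_nhds hi))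
  obtain ⟨p, hp⟩ := bddAbove_range_pointer (f := f) (k := k) (i := i) (T := T) fun t ht => by
    have := (hT t ht).le
    rw [← hcast] at this
    exact Rat.cast_le.1 this
  obtain ⟨l, hl⟩ := exists_eventually_eq_of_monotone_of_le (monotone_pointer f k) hp
  refine ⟨l, hl, le_of_tendsto (hf _) ?_⟩
  filter_upwards [hl, (tendsto_add_atTop_nat 1).eventually hl] with t ht ht'
  rw [pointer, Bool.cond_decide, ht] at ht'
  split_ifs at ht' with hlt
  · omega
  · rw [← hcast]
    exact Rat.cast_le.2 (not_lt.1 hlt)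

/-- The semidistribution with mass `2⁻ᵏ⁻¹` at the point with index `s k` of block `k`. -/
noncomputable def spikes (s : ℕ → ℕ) (x : ℕ) : ℝ :=
  if s x.unpair.1 = x.unpair.2 then ((2 ^ (x.unpair.1 + 1) : ℕ) : ℝ)⁻¹ else 0

theorem hasSum_spikes (s : ℕ → ℕ) : HasSum (spikes s) 1 := by
  have hinj : Function.Injective fun k => Nat.pair k (s k) :=
    fun a b h => (Nat.pair_eq_pair.1 h).1
  rw [← hinj.hasSum_iff]
  · convert hasSum_geometric_two' 1 using 2 with k
    simp [spikes, pow_succ]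
    ring
  · intro x hx
    refine if_neg fun h => hx ⟨x.unpair.1, ?_⟩
    simp [h]

theorem isSemidistribution_spikes (s : ℕ → ℕ) : IsSemidistribution (spikes s) := by
  refine ⟨fun x => ?_, (hasSum_spikes s).summable, (hasSum_spikes s).tsum_eq.le⟩
  unfold spikes
  split_ifs <;> positivity

theorem approximable_spikes {u : ℕ → ℕ → ℕ} (hu : Computable₂ u) {s : ℕ → ℕ}
    (hs : ∀ k, ∀ᶠ t in atTop, u k t = s k) : Approximable (spikes s) := by
  refine ⟨fun t x => bif decide (u x.unpair.1 t = x.unpair.2)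
    then ((2 ^ (x.unpair.1 + 1) : ℕ) : ℚ)⁻¹ else 0, ?_, fun x => ?_⟩
  · have h1 : Computable fun z : ℕ × ℕ => z.2.unpair.1 :=
      Computable.fst.comp (Computable.unpair.comp Computable.snd)
    have h2 : Computable fun z : ℕ × ℕ => z.2.unpair.2 :=
      Computable.snd.comp (Computable.unpair.comp Computable.snd)
    have hpow : Computable fun z : ℕ × ℕ => ((2 ^ (z.2.unpair.1 + 1) : ℕ) : ℚ)⁻¹ :=
      (Primrec.inv_natCast.to_comp.comp (Computable.pred.comp
        (Primrec.nat_pow.to_comp.comp (Computable.const 2) (Computable.succ.comp h1)))).of_eq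
        fun z => by
          rw [Nat.succ_eq_add_one, Nat.pred_eq_sub_one, Nat.sub_add_cancel Nat.one_le_two_pow]
    exact Computable.cond
      (Primrec.eq.decide.to_comp.comp (hu.comp h1 Computable.fst) h2) hpow (Computable.const 0)
  · refine tendsto_const_nhds.congr' ?_
    filter_upwards [hs x.unpair.1] with t ht
    rw [ht, Bool.cond_decide, spikes]
    split_ifs <;> simp

/-- There is no universal approximable semidistribution. -/
theorem no_universal_approximable_semidistribution
    (P₀ : ℕ → ℝ) (hP₀ : IsSemidistribution P₀) (hP₀a : Approximable P₀) :
    ∃ Q : ℕ → ℝ, IsSemidistribution Q ∧ Approximable Q ∧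
      ¬ ∃ c : ℝ, 0 < c ∧ ∀ x, P₀ x ≥ c * Q x := by
  obtain ⟨f, hf, hlim⟩ := hP₀a
  choose l hl hle using exists_pointer_limit hP₀.2.1 hlim
  refine ⟨spikes fun k => (l k).unpair.1, isSemidistribution_spikes _,
    approximable_spikes (u := fun k t => (pointer f k t).unpair.1)
      (Computable.fst.comp (Computable.unpair.comp (computable_pointer hf)))
      fun k => (hl k).mono fun t ht => by rw [ht], ?_⟩
  rintro ⟨c, hc, hdom⟩
  obtain ⟨k, hk⟩ := pow_unbounded_of_one_lt (2 / c) (one_lt_two (α := ℝ))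
  have h := (hdom (Nat.pair k (l k).unpair.1)).le.trans (hle k)
  simp only [spikes, Nat.unpair_pair, if_true] at h
  push_cast at h
  rw [← div_eq_mul_inv, inv_eq_one_div, div_le_div_iff₀ (by positivity) (by positivity),
    show (4 : ℝ) = 2 * 2 by norm_num, mul_pow, pow_succ] at h
  have h2 : (0 : ℝ) < 2 ^ k := by positivity
  rw [div_lt_iff₀ hc] at hk
  nlinarith
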